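/- Let f : ℝ → ℝ be continuous and F(t) = ∫₀ᵗ f(s) ds. Assume there exists θ > 0 such that 0 < θ·F(t) ≤ t·f(t) for all t ≠ 0. Then for every t ≠ 0 and every β ≥ 1, F(β·t) ≥ β^θ · F(t). -/

import Mathlib

open Real intervalIntegral

/-- Along a ray, `F (b * t) / b ^ θ` is nondecreasing when `θ * F x ≤ x * F' x` off the origin. -/
theorem monotoneOn_comp_mul_mul_rpow_neg {f F : ℝ → ℝ} {θ t : ℝ}
    (hF : ∀ x, HasDerivAt F (f x) x) (h : ∀ x, x ≠ 0 → θ * F x ≤ x * f x) (ht : t ≠ 0) :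
    MonotoneOn (fun b : ℝ => F (b * t) * b ^ (-θ)) (Set.Ioi 0) := by
  have hderiv : ∀ b ∈ Set.Ioi (0 : ℝ), HasDerivAt (fun b : ℝ => F (b * t) * b ^ (-θ))
      (b ^ (-θ - 1) * (b * t * f (b * t) - θ * F (b * t))) b := by
    intro b hb
    have hb : 0 < b := hb
    have h₁ : HasDerivAt (fun b : ℝ => F (b * t)) (f (b * t) * t) b := by
      simpa [Function.comp_def] using (hF (b * t)).comp b ((hasDerivAt_id b).mul_const t)
    have h₂ := Real.hasDerivAt_rpow_const (x := b) (p := -θ) (Or.inl hb.ne')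
    refine (h₁.mul h₂).congr_deriv ?_
    have h₃ : b ^ (-θ) = b ^ (-θ - 1) * b := by
      rw [← Real.rpow_add_one hb.ne', sub_add_cancel]
    rw [h₃]
    ring
  refine monotoneOn_of_deriv_nonneg (convex_Ioi 0)
    (fun b hb => (hderiv b hb).continuousAt.continuousWithinAt) ?_ ?_
  · rw [interior_Ioi]
    exact fun b hb => (hderiv b hb).differentiableAt.differentiableWithinAt
  · rw [interior_Ioi]
    intro b hb
    rw [(hderiv b hb).deriv]
    have hb : 0 < b := hb
    exact mul_nonneg (Real.rpow_nonneg hb.le _)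
      (sub_nonneg.2 (h _ (mul_ne_zero hb.ne' ht)))

theorem stmt0 (f : ℝ → ℝ) (hf : Continuous f)
    (F : ℝ → ℝ) (hF : ∀ t, F t = ∫ s in (0:ℝ)..t, f s)
    (θ : ℝ) (hθ : 0 < θ)
    (hAR : ∀ t : ℝ, t ≠ 0 → 0 < θ * F t ∧ θ * F t ≤ t * f t) :
    ∀ t : ℝ, t ≠ 0 → ∀ β : ℝ, 1 ≤ β → F (β * t) ≥ β ^ θ * F t := by
  intro t ht β hβ
  have hβ₀ : 0 < β := zero_lt_one.trans_le hβ
  have hderiv : ∀ x, HasDerivAt F (f x) x := by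
    intro x
    rw [funext hF]
    exact hf.integral_hasStrictDerivAt 0 x |>.hasDerivAt
  have hmono := monotoneOn_comp_mul_mul_rpow_neg hderiv (fun x hx => (hAR x hx).2) ht
    (Set.mem_Ioi.2 zero_lt_one) (Set.mem_Ioi.2 hβ₀) hβ
  simp only [one_mul, Real.one_rpow, mul_one, Real.rpow_neg hβ₀.le, ← div_eq_mul_inv] at hmono
  rw [le_div_iff₀ (Real.rpow_pos_of_pos hβ₀ θ)] at hmono
  linarith
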